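/- Let A = a₀ + 𝐚 + 𝒜 + a₁₂₃I be a multivector in Cl(0,3) with a₊ = 0 (equivalently a₁ = a₂₃, a₂ = -a₁₃, a₃ = a₁₂), a₀ + a₁₂₃ > 0, and a₋ > 0. Let Û be any bivector of Cl(0,3) with Û² = -1, and let c₂₊, c₁₊, c₁₋ be any integers. Define A₀₊ = log(a₀ + a₁₂₃) + 2πc₂₊·Û, A₀₋ = (1/2)·log((a₀ - a₁₂₃)² + a₋²), A₁₂₊ = (1/(a₀ + a₁₂₃) + 2πc₁₊)·(1 + I)·(𝐚 + 𝒜), A₁₂₋ = ((atan2(a₋, a₀ - a₁₂₃) + 2πc₁₋)/a₋)·(1 - I)·(𝐚 + 𝒜), and L = (1/2)·(A₀₊ + A₀₋ + A₁₂₊ + A₁₂₋ + (A₀₊ - A₀₋)·I). Then exp L = A. -/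

import Mathlib

open Real CliffordAlgebra

noncomputable section

/-- The quadratic form of signature (0,3): `Q(x) = -(x₁² + x₂² + x₃²)`. -/
def Q03 : QuadraticForm ℝ (Fin 3 → ℝ) := QuadraticMap.weightedSumSquares ℝ ![-1, -1, -1]

/-- The real Clifford algebra Cl(0,3). -/
abbrev Cl03 := CliffordAlgebra Q03

/-- The canonical (module) topology on the finite-dimensional real algebra Cl(0,3). -/
instance : TopologicalSpace Cl03 := moduleTopology ℝ Cl03

/-- The orthonormal generators `e₁, e₂, e₃` (indexed here by `0, 1, 2`). -/
def e (i : Fin 3) : Cl03 := ι Q03 (Pi.single i 1)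

/-- The pseudoscalar `I = e₁e₂e₃`. -/
def I3 : Cl03 := e 0 * e 1 * e 2

/-- The exponential `exp M = ∑ₖ Mᵏ/k!` in Cl(0,3). -/
def expCl (M : Cl03) : Cl03 := ∑' n : ℕ, (n.factorial : ℝ)⁻¹ • M ^ n

/-- `atan2 y x` is the argument in `(-π, π]` of the complex number `x + iy`. -/
def atan2 (y x : ℝ) : ℝ := Complex.arg ⟨x, y⟩

instance : IsModuleTopology ℝ Cl03 := ⟨rfl⟩

instance : IsTopologicalAddGroup Cl03 := IsModuleTopology.topologicalAddGroup ℝ Cl03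

instance : T2Space Cl03 := by
  refine T2Space.of_injective_continuous
    (f := fun (x : Cl03) (φ : Module.Dual ℝ Cl03) => φ x) (fun x y h => ?_) ?_
  · rw [← sub_eq_zero, ← Module.forall_dual_apply_eq_zero_iff ℝ]
    intro φ
    rw [map_sub, sub_eq_zero]
    exact congrFun h φ
  · exact continuous_pi fun φ => IsModuleTopology.continuous_of_linearMap φ

lemma Q03_single (i : Fin 3) : Q03 (Pi.single i 1) = -1 := by
  fin_cases i <;> simp [Q03, QuadraticMap.weightedSumSquares_apply, Fin.sum_univ_three]

lemma e_mul_self (i : Fin 3) : e i * e i = -1 := by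
  rw [e, ι_sq_scalar, Q03_single]
  simp

lemma e_mul_e_of_ne {i j : Fin 3} (h : i ≠ j) : e i * e j = -(e j * e i) := by
  apply ι_mul_ι_comm_of_isOrtho
  rw [QuadraticMap.isOrtho_def, Q03_single, Q03_single]
  fin_cases i <;> fin_cases j <;>
    simp [Q03, QuadraticMap.weightedSumSquares_apply, Fin.sum_univ_three] at h ⊢

lemma e_mul_e_mul_self (i : Fin 3) (x : Cl03) : e i * (e i * x) = -x := by
  rw [← mul_assoc, e_mul_self, neg_one_mul]

lemma e_mul_e_mul_of_ne {i j : Fin 3} (h : i ≠ j) (x : Cl03) :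
    e i * (e j * x) = -(e j * (e i * x)) := by
  rw [← mul_assoc, e_mul_e_of_ne h, neg_mul, mul_assoc]

lemma e_one_mul_e_zero : e 1 * e 0 = -(e 0 * e 1) := e_mul_e_of_ne (by decide)
lemma e_two_mul_e_zero : e 2 * e 0 = -(e 0 * e 2) := e_mul_e_of_ne (by decide)
lemma e_two_mul_e_one : e 2 * e 1 = -(e 1 * e 2) := e_mul_e_of_ne (by decide)

lemma e_one_mul_e_zero_mul (x : Cl03) : e 1 * (e 0 * x) = -(e 0 * (e 1 * x)) :=
  e_mul_e_mul_of_ne (by decide) x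
lemma e_two_mul_e_zero_mul (x : Cl03) : e 2 * (e 0 * x) = -(e 0 * (e 2 * x)) :=
  e_mul_e_mul_of_ne (by decide) x
lemma e_two_mul_e_one_mul (x : Cl03) : e 2 * (e 1 * x) = -(e 1 * (e 2 * x)) :=
  e_mul_e_mul_of_ne (by decide) x

lemma I3_mul_self : I3 * I3 = 1 := by
  simp [I3, mul_assoc, e_mul_self, e_one_mul_e_zero_mul, e_two_mul_e_zero_mul,
    e_two_mul_e_one_mul]

lemma commute_I3_e (i : Fin 3) : Commute I3 (e i) := by
  fin_cases i <;>
  simp [Commute, SemiconjBy, I3, mul_assoc, e_mul_self, e_mul_e_mul_self, e_two_mul_e_zero,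
    e_two_mul_e_one, e_one_mul_e_zero_mul, e_two_mul_e_zero_mul, e_two_mul_e_one_mul]

lemma commute_I3 (x : Cl03) : Commute I3 x := by
  have hv (v : Fin 3 → ℝ) : ι Q03 v = v 0 • e 0 + v 1 • e 1 + v 2 • e 2 := by
    simp only [e, ← map_smul, ← map_add]
    congr 1
    ext j
    fin_cases j <;> simp
  induction x using CliffordAlgebra.induction with
  | algebraMap r => exact Algebra.commutes' r I3 |>.symm
  | ι v =>
    rw [hv]
    exact (((commute_I3_e 0).smul_right _).add_right ((commute_I3_e 1).smul_right _)).add_right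
      ((commute_I3_e 2).smul_right _)
  | mul x y hx hy => exact hx.mul_right hy
  | add x y hx hy => exact hx.add_right hy

lemma bivector_mul_self (b12 b13 b23 : ℝ) :
    (b12 • (e 0 * e 1) + b13 • (e 0 * e 2) + b23 • (e 1 * e 2)) *
      (b12 • (e 0 * e 1) + b13 • (e 0 * e 2) + b23 • (e 1 * e 2)) =
      -((b12 ^ 2 + b13 ^ 2 + b23 ^ 2) • (1 : Cl03)) := by
  simp only [add_mul, mul_add, smul_mul_assoc, mul_smul_comm, mul_assoc, e_mul_self,
    e_mul_e_mul_self, e_one_mul_e_zero, e_two_mul_e_one, e_one_mul_e_zero_mul,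
    e_two_mul_e_zero_mul, e_two_mul_e_one_mul, mul_neg, neg_neg, mul_one]
  module

lemma one_sub_I3_mul_vector_add_bivector (a1 a2 a3 a12 a13 a23 : ℝ) :
    (1 - I3) * (a1 • e 0 + a2 • e 1 + a3 • e 2 +
      (a12 • (e 0 * e 1) + a13 • (e 0 * e 2) + a23 • (e 1 * e 2))) =
    (1 - I3) * ((a3 + a12) • (e 0 * e 1) + (a13 - a2) • (e 0 * e 2) + (a1 + a23) • (e 1 * e 2)) := by
  simp only [I3, sub_mul, one_mul, mul_add, mul_smul_comm, mul_assoc,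
    e_mul_self, e_mul_e_mul_self, e_one_mul_e_zero, e_two_mul_e_zero, e_two_mul_e_one,
    e_one_mul_e_zero_mul, e_two_mul_e_zero_mul, e_two_mul_e_one_mul, mul_neg, neg_neg, mul_one]
  module

lemma one_add_I3_mul_vector_add_bivector (a1 a2 a3 : ℝ) :
    (1 + I3) * (a1 • e 0 + a2 • e 1 + a3 • e 2 +
      (a3 • (e 0 * e 1) + (-a2) • (e 0 * e 2) + a1 • (e 1 * e 2))) = 0 := by
  simp only [I3, one_mul, add_mul, mul_add, mul_smul_comm, mul_assoc,
    e_mul_self, e_mul_e_mul_self, e_one_mul_e_zero, e_two_mul_e_zero, e_two_mul_e_one,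
    e_one_mul_e_zero_mul, e_two_mul_e_zero_mul, e_two_mul_e_one_mul, mul_neg, neg_neg, mul_one]
  module

lemma add_mul_pow_of_orthogonal_idempotents {R : Type*} [Ring R] {p q : R} (hpq : p + q = 1)
    (hpp : p * p = p) (hp : ∀ x, Commute p x) (x y : R) (n : ℕ) :
    (p * x + q * y) ^ n = p * x ^ n + q * y ^ n := by
  obtain rfl : q = 1 - p := by rw [← hpq, add_sub_cancel_left]
  have hpv (u v : R) : u * (p * v) = p * (u * v) := by
    rw [← mul_assoc, ← (hp u).eq, mul_assoc]
  induction n with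
  | zero => simp
  | succ n ih =>
    rw [pow_succ, ih, pow_succ, pow_succ]
    simp only [sub_mul, one_mul, mul_add, add_mul, mul_sub, hpv, mul_assoc]
    simp only [← mul_assoc p p, hpp]
    abel

lemma hasSum_mul_algHom_exp (p : Cl03) (φ : ℂ →ₐ[ℝ] Cl03) (z : ℂ) :
    HasSum (fun n : ℕ => (n.factorial : ℝ)⁻¹ • (p * φ z ^ n)) (p * φ (Complex.exp z)) := by
  have h := NormedSpace.exp_series_hasSum_exp' (𝕂 := ℝ) z
  rw [← Complex.exp_eq_exp_ℂ] at h
  let f : ℂ →ₗ[ℝ] Cl03 := (LinearMap.mulLeft ℝ p).comp φ.toLinearMap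
  have hf : Continuous f := f.continuous_of_finiteDimensional
  refine (h.map f hf).congr_fun fun n => ?_
  simp only [Function.comp_apply, map_smul]
  simp [f]

lemma expCl_add_mul {p q : Cl03} (hpq : p + q = 1) (hpp : p * p = p) (hp : ∀ x, Commute p x)
    (φ ψ : ℂ →ₐ[ℝ] Cl03) (z w : ℂ) :
    expCl (p * φ z + q * ψ w) = p * φ (Complex.exp z) + q * ψ (Complex.exp w) := by
  refine HasSum.tsum_eq ?_
  simpa only [add_mul_pow_of_orthogonal_idempotents hpq hpp hp, smul_add] using
    (hasSum_mul_algHom_exp p φ z).add (hasSum_mul_algHom_exp q ψ w)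

/-- special-case logarithm in Cl(0,3) when `a₊ = 0` and `a₀ + a₁₂₃ > 0`. -/
theorem exp_specialLog_Cl03
    (a0 a1 a2 a3 a12 a13 a23 a123 ap am d12 d13 d23 : ℝ) (c2p c1p c1m : ℤ)
    (va bA A U A0p A0m A12p A12m L : Cl03)
    (hva : va = a1 • e 0 + a2 • e 1 + a3 • e 2)
    (hbA : bA = a12 • (e 0 * e 1) + a13 • (e 0 * e 2) + a23 • (e 1 * e 2))
    (hA : A = algebraMap ℝ Cl03 a0 + va + bA + a123 • I3)
    (hap : ap = Real.sqrt ((a3 - a12) ^ 2 + (a2 + a13) ^ 2 + (a1 - a23) ^ 2))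
    (ham : am = Real.sqrt ((a3 + a12) ^ 2 + (a2 - a13) ^ 2 + (a1 + a23) ^ 2))
    (hapzero : ap = 0) (ha0 : 0 < a0 + a123) (hampos : 0 < am)
    (hU : U = d12 • (e 0 * e 1) + d13 • (e 0 * e 2) + d23 • (e 1 * e 2))
    (hU2 : U * U = -1)
    (hA0p : A0p = algebraMap ℝ Cl03 (Real.log (a0 + a123)) + (2 * π * c2p) • U)
    (hA0m : A0m = algebraMap ℝ Cl03 ((1 / 2) * Real.log ((a0 - a123) ^ 2 + am ^ 2)))
    (hA12p : A12p = (1 / (a0 + a123) + 2 * π * c1p) • ((1 + I3) * (va + bA)))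
    (hA12m : A12m = ((atan2 am (a0 - a123) + 2 * π * c1m) / am) • ((1 - I3) * (va + bA)))
    (hL : L = (1 / 2 : ℝ) • (A0p + A0m + A12p + A12m + (A0p - A0m) * I3)) :
    expCl L = A := by
  have hsq : (a3 - a12) ^ 2 + (a2 + a13) ^ 2 + (a1 - a23) ^ 2 = 0 :=
    (Real.sqrt_eq_zero (by positivity)).1 (hap ▸ hapzero)
  obtain rfl : a12 = a3 := by
    nlinarith [sq_nonneg (a3 - a12), sq_nonneg (a2 + a13), sq_nonneg (a1 - a23)]
  obtain rfl : a13 = -a2 := by nlinarith [sq_nonneg (a2 + a13), sq_nonneg (a1 - a23)]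
  obtain rfl : a23 = a1 := by nlinarith [sq_nonneg (a1 - a23)]
  have hplus : (1 + I3) * (va + bA) = 0 := by
    rw [hva, hbA, one_add_I3_mul_vector_add_bivector]
  set B : Cl03 := (a12 + a12) • (e 0 * e 1) + (-a2 - a2) • (e 0 * e 2) +
    (a23 + a23) • (e 1 * e 2) with hB
  have hminus : (1 - I3) * (va + bA) = (1 - I3) * B := by
    rw [hva, hbA, one_sub_I3_mul_vector_add_bivector]
  have ham2 : am ^ 2 = (a12 + a12) ^ 2 + (-a2 - a2) ^ 2 + (a23 + a23) ^ 2 := by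
    rw [ham, Real.sq_sqrt (by positivity)]
    ring
  have hBB : B * B = -(am ^ 2 • (1 : Cl03)) := by
    rw [hB, bivector_mul_self, ham2]
  have hJ : (am⁻¹ • B) * (am⁻¹ • B) = -1 := by
    rw [smul_mul_smul_comm, hBB, smul_neg, smul_smul]
    field_simp
    simp
  set p : Cl03 := (1 / 2 : ℝ) • (1 + I3) with hp
  set q : Cl03 := (1 / 2 : ℝ) • (1 - I3) with hq
  have hpq : p + q = 1 := by
    rw [hp, hq]
    module
  have hpp : p * p = p := by
    rw [hp, smul_mul_smul_comm, add_mul, mul_add, mul_add, I3_mul_self, one_mul, one_mul, mul_one]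
    module
  have hpc (x : Cl03) : Commute p x :=
    ((Commute.one_left x).add_left (commute_I3 x)).smul_left _
  set θ : ℝ := atan2 am (a0 - a123) + 2 * π * c1m with hθ
  set r : ℝ := (a0 - a123) ^ 2 + am ^ 2 with hr
  have hr0 : 0 < r := by positivity
  set φ : ℂ →ₐ[ℝ] Cl03 := Complex.lift ⟨U, hU2⟩
  set ψ : ℂ →ₐ[ℝ] Cl03 := Complex.lift ⟨am⁻¹ • B, hJ⟩
  set z : ℂ := Real.log (a0 + a123) + (2 * π * c2p : ℝ) * Complex.I with hz
  set w : ℂ := (1 / 2 * Real.log r : ℝ) + (θ : ℝ) * Complex.I with hw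
  have hφ (x y : ℝ) : φ (x + y * Complex.I) = algebraMap ℝ Cl03 x + y • U := by
    simp [φ, Complex.liftAux_apply]
  have hψ (x y : ℝ) : ψ (x + y * Complex.I) = algebraMap ℝ Cl03 x + y • (am⁻¹ • B) := by
    simp [ψ, Complex.liftAux_apply]
  have hLpq : L = p * φ z + q * ψ w := by
    rw [hz, hw, hφ, hψ, ← hA0p, mul_add, ← hA0m, hL, hA12p, hplus, hA12m, hminus, hp, hq,
      ← (commute_I3 _).eq]
    simp only [smul_mul_assoc, mul_smul_comm, add_mul, sub_mul, one_mul, mul_sub]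
    module
  have hez : Complex.exp z = ((a0 + a123 : ℝ) : ℂ) + (0 : ℝ) * Complex.I := by
    have h1 : Complex.exp ((2 * π * c2p : ℝ) * Complex.I) = 1 := by
      rw [Complex.exp_eq_one_iff]
      exact ⟨c2p, by push_cast; ring⟩
    rw [hz, Complex.exp_add, h1, ← Complex.ofReal_exp, Real.exp_log ha0]
    simp
  have hew : Complex.exp w = ((a0 - a123 : ℝ) : ℂ) + (am : ℝ) * Complex.I := by
    have h1 : Complex.exp ((θ : ℝ) * Complex.I) =
        Complex.exp (Complex.arg ⟨a0 - a123, am⟩ * Complex.I) := by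
      rw [Complex.exp_eq_exp_iff_exists_int]
      exact ⟨c1m, by rw [hθ, atan2]; push_cast; ring⟩
    have h2 : Real.exp (1 / 2 * Real.log r) = ‖(⟨a0 - a123, am⟩ : ℂ)‖ := by
      rw [Complex.norm_def, Complex.normSq_mk, mul_comm, Real.exp_mul, Real.exp_log hr0,
        ← Real.sqrt_eq_rpow, hr, sq, sq]
    rw [hw, Complex.exp_add, h1, ← Complex.ofReal_exp, h2, Complex.norm_mul_exp_arg_mul_I,
      Complex.mk_eq_add_mul_I]
  rw [hLpq, expCl_add_mul hpq hpp hpc, hez, hew, hφ, hψ, smul_inv_smul₀ hampos.ne', zero_smul,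
    add_zero, mul_add, hA]
  have hqB : q * B = va + bA := by
    calc q * B = q * (va + bA) := by rw [hq, smul_mul_assoc, smul_mul_assoc, hminus]
      _ = (p + q) * (va + bA) := by rw [add_mul, hp, smul_mul_assoc (1 / 2 : ℝ) (1 + I3), hplus, smul_zero, zero_add]
      _ = va + bA := by rw [hpq, one_mul]
  rw [hqB, hp, hq]
  simp only [Algebra.algebraMap_eq_smul_one, mul_smul_comm, mul_one]
  module
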